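/- There is a constant C > 0, independent of T and f, such that for every T > 0 and every smooth scalar function f on [0,T]×ℝ³ which is Schwartz in the space variable for each t, one has the anisotropic Gagliardo–Nirenberg–Sobolev estimate ‖f‖_{L⁴_T(L⁴(ℝ³))} ≤ C ‖f‖_{L^∞_T(L²(ℝ³))}^{1/4} ‖∂₃f‖_{L^∞_T(L²(ℝ³))}^{1/4} ‖∇_h f‖_{L²_T(L²(ℝ³))}^{1/2}. -/

import Mathlib

open MeasureTheory Real Set Filter
open scoped ENNReal NNReal

noncomputable section

/-- Spatial points of `ℝ³`. -/
abbrev Pt : Type := Fin 3 → ℝ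

/-- Partial derivative in the `i`-th coordinate direction. -/
def pd (i : Fin 3) (f : Pt → ℝ) : Pt → ℝ := fun x => fderiv ℝ f x (Pi.single i 1)

/-- Iterated partial derivative `∂^α` for a multi-index `α`. -/
def pdM (α : Fin 3 → ℕ) (f : Pt → ℝ) : Pt → ℝ :=
  (pd 0)^[α 0] ((pd 1)^[α 1] ((pd 2)^[α 2] f))

/-- Multi-indices of total degree at most `k`. -/
def midx (k : ℕ) : Finset (Fin 3 → ℕ) :=
  (Fintype.piFinset fun _ => Finset.range (k + 1)).filter fun α => ∑ i, α i ≤ k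

/-- The `H^k` inner product `(f|g)_{H^k} = ∑_{|α| ≤ k} ∫ ∂^α f ∂^α g`. -/
def hInner (k : ℕ) (f g : Pt → ℝ) : ℝ := ∑ α ∈ midx k, ∫ x : Pt, pdM α f x * pdM α g x

/-- The squared `H^k` norm. -/
def hSq (k : ℕ) (f : Pt → ℝ) : ℝ := hInner k f f

/-- The squared `L²` norm. -/
def l2Sq (f : Pt → ℝ) : ℝ := ∫ x : Pt, (f x) ^ 2

/-- The Laplacian. -/
def lapl (f : Pt → ℝ) : Pt → ℝ := fun x => ∑ i, pd i (pd i f) x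

/-- Horizontal directions. -/
def hIdx : Finset (Fin 3) := {0, 1}

/-- `L^∞` norm in time over `[0,T]` of a (nonnegative) function of time. -/
def supT (T : ℝ) (g : ℝ → ℝ) : ℝ := sSup (g '' Icc 0 T)

/-- `L²` norm in time over `[0,T]`. -/
def l2T (T : ℝ) (g : ℝ → ℝ) : ℝ := Real.sqrt (∫ t in (0:ℝ)..T, (g t) ^ 2)

/-- `L⁴` norm in time over `[0,T]`. -/
def l4T (T : ℝ) (g : ℝ → ℝ) : ℝ := (∫ t in (0:ℝ)..T, (g t) ^ 4) ^ ((1:ℝ)/4)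

/-- A function is Schwartz: smooth with all derivatives rapidly decaying. -/
def IsSchwartz (f : Pt → ℝ) : Prop :=
  ContDiff ℝ (⊤ : ℕ∞) f ∧ ∀ k n : ℕ, ∃ C : ℝ, ∀ x, ‖x‖ ^ k * ‖iteratedFDeriv ℝ n f x‖ ≤ C

/-- Smoothness of `f` jointly in `(t,x)` on `s ×ˢ ℝ³`. -/
def SmoothOn2 (s : Set ℝ) (f : ℝ → Pt → ℝ) : Prop :=
  ContDiffOn ℝ (⊤ : ℕ∞) (fun q : ℝ × Pt => f q.1 q.2) (s ×ˢ (univ : Set Pt))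

/-- `‖∇f‖_{H^k}²`. -/
def gradHSq (k : ℕ) (f : Pt → ℝ) : ℝ := ∑ i, hSq k (pd i f)

/-- `‖∇_h∇f‖_{H^k}²`. -/
def gradHHSq (k : ℕ) (f : Pt → ℝ) : ℝ := ∑ i ∈ hIdx, ∑ j, hSq k (pd i (pd j f))

/-- `‖v‖_{H^k}²` for a vector field. -/
def vecHSq (k : ℕ) (v : Fin 3 → Pt → ℝ) : ℝ := ∑ j, hSq k (v j)

/-- `‖∇v‖_{H^k}²` for a vector field. -/
def gradVecHSq (k : ℕ) (v : Fin 3 → Pt → ℝ) : ℝ := ∑ j, gradHSq k (v j)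

/-- `B_T²`. -/
def BTsq (T : ℝ) (ψ : ℝ → Pt → ℝ) (v : Fin 3 → ℝ → Pt → ℝ) : ℝ :=
  (supT T fun t => Real.sqrt (vecHSq 2 fun j => v j t)) ^ 2
  + (supT T fun t => Real.sqrt (gradHSq 2 (ψ t))) ^ 2
  + (l2T T fun t => Real.sqrt (gradVecHSq 2 fun j => v j t)) ^ 2
  + (l2T T fun t => Real.sqrt (gradHHSq 1 (ψ t))) ^ 2

/-- `B_T`. -/
def BT (T : ℝ) (ψ : ℝ → Pt → ℝ) (v : Fin 3 → ℝ → Pt → ℝ) : ℝ := Real.sqrt (BTsq T ψ v)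

/-- The transport equation `∂_tψ + v·∇ψ + v₃ = 0` on `s × ℝ³`. -/
def TransportEq (s : Set ℝ) (ψ : ℝ → Pt → ℝ) (v : Fin 3 → ℝ → Pt → ℝ) : Prop :=
  ∀ t ∈ s, ∀ x, deriv (fun τ => ψ τ x) t + (∑ i, v i t x * pd i (ψ t) x) + v 2 t x = 0

/-- Divergence-free condition on `s × ℝ³`. -/
def DivFree (s : Set ℝ) (v : Fin 3 → ℝ → Pt → ℝ) : Prop :=
  ∀ t ∈ s, ∀ x, (∑ i, pd i (fun y => v i t y) x) = 0

/-- The momentum equations of system (S) on `s × ℝ³`. -/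
def MomentumEq (s : Set ℝ) (ψ : ℝ → Pt → ℝ) (v : Fin 3 → ℝ → Pt → ℝ)
    (p : ℝ → Pt → ℝ) : Prop :=
  ∀ j : Fin 3, ∀ t ∈ s, ∀ x,
    deriv (fun τ => v j τ x) t + (∑ i, v i t x * pd i (v j t) x) - lapl (v j t) x
      + pd j (p t) x + pd j (pd 2 (ψ t)) x + (if j = 2 then lapl (ψ t) x else 0)
    = - ∑ i, pd i (fun y => pd j (ψ t) y * pd i (ψ t) y) x

/-- The full system (S) on `s × ℝ³`. -/
def SolvesS (s : Set ℝ) (ψ : ℝ → Pt → ℝ) (v : Fin 3 → ℝ → Pt → ℝ)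
    (p : ℝ → Pt → ℝ) : Prop :=
  TransportEq s ψ v ∧ MomentumEq s ψ v p ∧ DivFree s v

/-- Finiteness of the four norms entering `B_T`. -/
def FiniteClass (T : ℝ) (ψ : ℝ → Pt → ℝ) (v : Fin 3 → ℝ → Pt → ℝ) : Prop :=
  BddAbove ((fun t => Real.sqrt (vecHSq 2 fun j => v j t)) '' Icc 0 T) ∧
  BddAbove ((fun t => Real.sqrt (gradHSq 2 (ψ t))) '' Icc 0 T) ∧
  IntervalIntegrable (fun t => gradVecHSq 2 fun j => v j t) volume 0 T ∧
  IntervalIntegrable (fun t => gradHHSq 1 (ψ t)) volume 0 T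

/-- The Cauchy–Schwarz inequality for lower Lebesgue integrals. -/
theorem lintegral_mul_le_sqrt_mul_sqrt {α : Type*} [MeasurableSpace α] (μ : Measure α)
    {f g : α → ℝ≥0∞} (hf : Measurable f) (hg : Measurable g) :
    ∫⁻ a, f a * g a ∂μ ≤
      (∫⁻ a, f a ^ 2 ∂μ) ^ ((1:ℝ)/2) * (∫⁻ a, g a ^ 2 ∂μ) ^ ((1:ℝ)/2) := by
  have h := ENNReal.lintegral_mul_le_Lp_mul_Lq μ Real.HolderConjugate.two_two
    hf.aemeasurable hg.aemeasurable
  simpa using h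

/-- Ladyzhenskaya's inequality on a product space, for functions whose squares are controlled by
integrals along lines. -/
theorem lintegral_pow_four_le_of_sq_le_prod {α β : Type*} [MeasurableSpace α] [MeasurableSpace β]
    (μ : Measure α) (ν : Measure β) [SFinite μ] [SFinite ν] {φ d₁ d₂ : α × β → ℝ≥0∞}
    (hφ : Measurable φ) (hd₁ : Measurable d₁) (hd₂ : Measurable d₂)
    (h₁ : ∀ a b, φ (a, b) ^ 2 ≤ ∫⁻ s, φ (s, b) * d₁ (s, b) ∂μ)
    (h₂ : ∀ a b, φ (a, b) ^ 2 ≤ ∫⁻ s, φ (a, s) * d₂ (a, s) ∂ν) :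
    ∫⁻ z, φ z ^ 4 ∂μ.prod ν ≤ (∫⁻ z, φ z ^ 2 ∂μ.prod ν) *
      ((∫⁻ z, d₁ z ^ 2 ∂μ.prod ν) ^ ((1:ℝ)/2) * (∫⁻ z, d₂ z ^ 2 ∂μ.prod ν) ^ ((1:ℝ)/2)) := by
  have m₁ : Measurable fun z => φ z * d₁ z := hφ.mul hd₁
  have m₂ : Measurable fun z => φ z * d₂ z := hφ.mul hd₂
  calc ∫⁻ z, φ z ^ 4 ∂μ.prod ν
      ≤ ∫⁻ z : α × β, (∫⁻ s, φ (z.1, s) * d₂ (z.1, s) ∂ν) * (∫⁻ s, φ (s, z.2) * d₁ (s, z.2) ∂μ)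
          ∂μ.prod ν := by
        refine lintegral_mono fun z => ?_
        rw [show φ z ^ 4 = φ z ^ 2 * φ z ^ 2 by ring]
        exact mul_le_mul' (h₂ z.1 z.2) (h₁ z.1 z.2)
    _ = (∫⁻ z, φ z * d₂ z ∂μ.prod ν) * ∫⁻ z, φ z * d₁ z ∂μ.prod ν := by
        rw [lintegral_prod_mul m₂.lintegral_prod_right'.aemeasurable
          m₁.lintegral_prod_left'.aemeasurable, lintegral_prod _ m₂.aemeasurable,
          lintegral_prod_symm _ m₁.aemeasurable]
    _ ≤ ((∫⁻ z, φ z ^ 2 ∂μ.prod ν) ^ ((1:ℝ)/2) * (∫⁻ z, d₂ z ^ 2 ∂μ.prod ν) ^ ((1:ℝ)/2)) *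
        ((∫⁻ z, φ z ^ 2 ∂μ.prod ν) ^ ((1:ℝ)/2) * (∫⁻ z, d₁ z ^ 2 ∂μ.prod ν) ^ ((1:ℝ)/2)) :=
        mul_le_mul' (lintegral_mul_le_sqrt_mul_sqrt _ hφ hd₂)
          (lintegral_mul_le_sqrt_mul_sqrt _ hφ hd₁)
    _ = _ := by
        rw [mul_mul_mul_comm, ← ENNReal.rpow_add_of_nonneg _ _ (by norm_num) (by norm_num),
          add_halves, ENNReal.rpow_one,
          mul_comm ((∫⁻ z, d₂ z ^ 2 ∂μ.prod ν) ^ ((1:ℝ)/2))]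

/-- The three-factor anisotropic version of `lintegral_pow_four_le_of_sq_le_prod`. -/
theorem lintegral_pow_four_le_of_sq_le_prod_prod {α β γ : Type*} [MeasurableSpace α]
    [MeasurableSpace β] [MeasurableSpace γ] (μ : Measure α) (ν : Measure β) (ρ : Measure γ)
    [SFinite μ] [SFinite ν] [SFinite ρ] {φ d₁ d₂ d₃ : γ × α × β → ℝ≥0∞}
    (hφ : Measurable φ) (hd₁ : Measurable d₁) (hd₂ : Measurable d₂) (hd₃ : Measurable d₃)
    (h₁ : ∀ c a b, φ (c, a, b) ^ 2 ≤ ∫⁻ s, φ (c, s, b) * d₁ (c, s, b) ∂μ)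
    (h₂ : ∀ c a b, φ (c, a, b) ^ 2 ≤ ∫⁻ s, φ (c, a, s) * d₂ (c, a, s) ∂ν)
    (h₃ : ∀ c a b, φ (c, a, b) ^ 2 ≤ ∫⁻ s, φ (s, a, b) * d₃ (s, a, b) ∂ρ) :
    ∫⁻ z, φ z ^ 4 ∂ρ.prod (μ.prod ν) ≤
      ((∫⁻ z, φ z ^ 2 ∂ρ.prod (μ.prod ν)) ^ ((1:ℝ)/2) *
        (∫⁻ z, d₃ z ^ 2 ∂ρ.prod (μ.prod ν)) ^ ((1:ℝ)/2)) *
      ((∫⁻ z, d₁ z ^ 2 ∂ρ.prod (μ.prod ν)) ^ ((1:ℝ)/2) *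
        (∫⁻ z, d₂ z ^ 2 ∂ρ.prod (μ.prod ν)) ^ ((1:ℝ)/2)) := by
  have m₃ : Measurable fun z => φ z * d₃ z := hφ.mul hd₃
  have hslice : ∀ c, ∫⁻ p, φ (c, p) ^ 2 ∂μ.prod ν ≤ ∫⁻ z, φ z * d₃ z ∂ρ.prod (μ.prod ν) := by
    intro c
    rw [lintegral_prod_symm _ m₃.aemeasurable]
    exact lintegral_mono fun p => h₃ c p.1 p.2
  have e₁ : Measurable fun c => ∫⁻ p, d₁ (c, p) ^ 2 ∂μ.prod ν :=
    (hd₁.pow_const 2).lintegral_prod_right'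
  have e₂ : Measurable fun c => ∫⁻ p, d₂ (c, p) ^ 2 ∂μ.prod ν :=
    (hd₂.pow_const 2).lintegral_prod_right'
  have hsq : ∀ x : ℝ≥0∞, (x ^ ((1:ℝ)/2)) ^ 2 = x := fun x => by
    rw [← ENNReal.rpow_natCast, ← ENNReal.rpow_mul]; norm_num
  calc ∫⁻ z, φ z ^ 4 ∂ρ.prod (μ.prod ν)
      = ∫⁻ c, ∫⁻ p, φ (c, p) ^ 4 ∂μ.prod ν ∂ρ := lintegral_prod _ (hφ.pow_const 4).aemeasurable
    _ ≤ ∫⁻ c, (∫⁻ z, φ z * d₃ z ∂ρ.prod (μ.prod ν)) *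
          ((∫⁻ p, d₁ (c, p) ^ 2 ∂μ.prod ν) ^ ((1:ℝ)/2) *
            (∫⁻ p, d₂ (c, p) ^ 2 ∂μ.prod ν) ^ ((1:ℝ)/2)) ∂ρ := by
        refine lintegral_mono fun c => ?_
        refine (lintegral_pow_four_le_of_sq_le_prod μ ν (φ := fun p => φ (c, p))
          (d₁ := fun p => d₁ (c, p)) (d₂ := fun p => d₂ (c, p)) (by fun_prop) (by fun_prop)
          (by fun_prop) (h₁ c) (h₂ c)).trans ?_
        exact mul_le_mul' (hslice c) le_rfl
    _ = (∫⁻ z, φ z * d₃ z ∂ρ.prod (μ.prod ν)) *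
          ∫⁻ c, (∫⁻ p, d₁ (c, p) ^ 2 ∂μ.prod ν) ^ ((1:ℝ)/2) *
            (∫⁻ p, d₂ (c, p) ^ 2 ∂μ.prod ν) ^ ((1:ℝ)/2) ∂ρ :=
        lintegral_const_mul _ ((e₁.pow_const _).mul (e₂.pow_const _))
    _ ≤ _ := by
        refine mul_le_mul' (lintegral_mul_le_sqrt_mul_sqrt _ hφ hd₃) ?_
        refine (lintegral_mul_le_sqrt_mul_sqrt ρ (e₁.pow_const _) (e₂.pow_const _)).trans_eq ?_
        simp only [hsq]
        rw [lintegral_prod _ (hd₁.pow_const 2).aemeasurable,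
          lintegral_prod _ (hd₂.pow_const 2).aemeasurable]

/-- A function on the line vanishing at `±∞` satisfies `‖h‖_∞² ≤ ∫ |h h'|`. -/
theorem enorm_sq_le_lintegral_mul_deriv {h h' : ℝ → ℝ} (hd : ∀ x, HasDerivAt h (h' x) x)
    (hbot : Tendsto h atBot (nhds 0)) (htop : Tendsto h atTop (nhds 0)) (a : ℝ) :
    ‖h a‖ₑ ^ 2 ≤ ∫⁻ s, ‖h s‖ₑ * ‖h' s‖ₑ := by
  simp_rw [← enorm_mul]
  have hc : Continuous h := continuous_iff_continuousAt.2 fun x => (hd x).continuousAt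
  have hm : AEStronglyMeasurable (fun s => h s * h' s) volume := by
    have : h' = deriv h := funext fun x => (hd x).deriv.symm
    rw [this]
    exact (hc.measurable.mul (measurable_deriv h)).aestronglyMeasurable
  by_cases hfin : ∫⁻ s, ‖h s * h' s‖ₑ = ⊤
  · rw [hfin]; exact le_top
  have hint : Integrable (fun s => h s * h' s) := ⟨hm, lt_top_iff_ne_top.2 hfin⟩
  have hint2 : Integrable (fun s => 2 * (h s * h' s)) := hint.const_mul 2
  have hd2 : ∀ x, HasDerivAt (fun s => h s ^ 2) (2 * (h x * h' x)) x := fun x => by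
    simpa [mul_assoc, Pi.pow_def] using (hd x).pow 2
  have h1 := integral_Iic_of_hasDerivAt_of_tendsto' (a := a) (fun x _ => hd2 x)
    hint2.integrableOn (by simpa using hbot.pow 2)
  have h2 := integral_Ioi_of_hasDerivAt_of_tendsto' (a := a) (fun x _ => hd2 x)
    hint2.integrableOn (by simpa using htop.pow 2)
  have h3 := norm_integral_le_integral_norm (μ := volume.restrict (Iic a))
    (fun s => 2 * (h s * h' s))
  have h4 := norm_integral_le_integral_norm (μ := volume.restrict (Ioi a))
    (fun s => 2 * (h s * h' s))
  have h5 := intervalIntegral.integral_Iic_add_Ioi (b := a) hint2.norm.integrableOn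
    hint2.norm.integrableOn
  have h6 : ∫ s, ‖2 * (h s * h' s)‖ = 2 * ∫ s, ‖h s * h' s‖ := by
    rw [← integral_const_mul]; simp [norm_mul]
  rw [h1, sub_zero] at h3
  rw [h2, zero_sub, norm_neg] at h4
  have h7 : h a ^ 2 ≤ ∫ s, ‖h s * h' s‖ := by
    have := le_norm_self (h a ^ 2)
    linarith
  rw [← ofReal_integral_norm_eq_lintegral_enorm hint, ← enorm_pow,
    Real.enorm_of_nonneg (sq_nonneg _)]
  exact ENNReal.ofReal_le_ofReal h7

/-- The Schwartz map underlying an `IsSchwartz` function. -/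
def IsSchwartz.toSchwartzMap {f : Pt → ℝ} (hf : IsSchwartz f) : SchwartzMap Pt ℝ :=
  ⟨f, hf.1, hf.2⟩

theorem IsSchwartz.integrable_sq {f : Pt → ℝ} (hf : IsSchwartz f) :
    Integrable fun x => f x ^ 2 :=
  (hf.toSchwartzMap.memLp 2 volume).integrable_sq

theorem IsSchwartz.continuous_pd {f : Pt → ℝ} (hf : IsSchwartz f) (i : Fin 3) :
    Continuous (pd i f) :=
  (hf.1.continuous_fderiv (by simp)).clm_apply continuous_const

theorem IsSchwartz.integrable_pd_sq {f : Pt → ℝ} (hf : IsSchwartz f) (i : Fin 3) :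
    Integrable fun x => pd i f x ^ 2 :=
  ((LineDeriv.lineDerivOp (Pi.single i (1:ℝ) : Pt) hf.toSchwartzMap :
    SchwartzMap Pt ℝ).memLp 2 volume).integrable_sq

theorem IsSchwartz.enorm_sq_le_lintegral {f : Pt → ℝ} (hf : IsSchwartz f) (i : Fin 3) (x : Pt) :
    ‖f x‖ₑ ^ 2 ≤
      ∫⁻ s, ‖f (Function.update x i s)‖ₑ * ‖pd i f (Function.update x i s)‖ₑ := by
  have hd : ∀ s, HasDerivAt (fun s => f (Function.update x i s))
      (pd i f (Function.update x i s)) s := fun s =>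
    ((hf.1.differentiable (by simp)) _).hasFDerivAt.comp_hasDerivAt s (hasDerivAt_update x i s)
  have hlim : Tendsto f (cocompact Pt) (nhds 0) := hf.toSchwartzMap.toZeroAtInfty.zero_at_infty'
  have hline : Tendsto (fun s : ℝ => Function.update x i s) (cocompact ℝ) (cocompact Pt) := by
    rw [← Metric.cobounded_eq_cocompact (α := Pt), ← tendsto_norm_atTop_iff_cobounded]
    refine tendsto_atTop_mono (fun s => ?_) (tendsto_norm_cocompact_atTop (E := ℝ))
    simpa using norm_le_pi_norm (Function.update x i s) i
  have hc := hlim.comp hline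
  simpa using enorm_sq_le_lintegral_mul_deriv hd (hc.mono_left atBot_le_cocompact)
    (hc.mono_left atTop_le_cocompact) (x i)

/-- Identification of `ℝ_v × ℝ²_h` with `ℝ³`. -/
def ofVertHor (z : ℝ × ℝ × ℝ) : Pt := ![z.2.1, z.2.2, z.1]

theorem measurePreserving_ofVertHor : MeasurePreserving ofVertHor := by
  have h := ((volume_preserving_piFinSuccAbove (fun _ : Fin 3 => ℝ) 2).symm).comp
    ((MeasurePreserving.id (volume : Measure ℝ)).prod
      (volume_preserving_finTwoArrow ℝ).symm)
  have he : ofVertHor = (MeasurableEquiv.piFinSuccAbove (fun _ : Fin 3 => ℝ) 2).symm ∘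
      Prod.map id MeasurableEquiv.finTwoArrow.symm := by
    funext z
    ext j
    fin_cases j <;> rfl
  rw [he]
  exact h

theorem lintegral_ofVertHor {g : Pt → ℝ≥0∞} (hg : Measurable g) :
    ∫⁻ z, g (ofVertHor z) ∂(volume : Measure ℝ).prod (volume.prod volume) = ∫⁻ x, g x :=
  measurePreserving_ofVertHor.lintegral_comp hg

theorem ofVertHor_update_zero (c a b s : ℝ) :
    Function.update (ofVertHor (c, a, b)) 0 s = ofVertHor (c, s, b) := by
  ext j; fin_cases j <;> rfl

theorem ofVertHor_update_one (c a b s : ℝ) :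
    Function.update (ofVertHor (c, a, b)) 1 s = ofVertHor (c, a, s) := by
  ext j; fin_cases j <;> rfl

theorem ofVertHor_update_two (c a b s : ℝ) :
    Function.update (ofVertHor (c, a, b)) 2 s = ofVertHor (s, a, b) := by
  ext j; fin_cases j <;> rfl

theorem lintegral_enorm_sq_eq_ofReal_l2Sq {g : Pt → ℝ} (hg : Integrable fun x => g x ^ 2) :
    ∫⁻ x, ‖g x‖ₑ ^ 2 = ENNReal.ofReal (l2Sq g) := by
  rw [l2Sq, ofReal_integral_eq_lintegral_ofReal hg (ae_of_all _ fun x => sq_nonneg _)]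
  refine lintegral_congr fun x => ?_
  rw [← enorm_pow, Real.enorm_of_nonneg (sq_nonneg _)]

theorem l2Sq_nonneg (g : Pt → ℝ) : 0 ≤ l2Sq g := integral_nonneg fun _ => sq_nonneg _

/-- The anisotropic Gagliardo–Nirenberg–Sobolev inequality at a fixed time. -/
theorem IsSchwartz.integral_pow_four_le {f : Pt → ℝ} (hf : IsSchwartz f) :
    ∫ x, f x ^ 4 ≤ √(l2Sq f) * √(l2Sq (pd 2 f)) * (√(l2Sq (pd 0 f)) * √(l2Sq (pd 1 f))) := by
  have mf : Measurable fun x => ‖f x‖ₑ := hf.1.continuous.measurable.enorm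
  have md : ∀ i, Measurable fun x => ‖pd i f x‖ₑ := fun i => (hf.continuous_pd i).measurable.enorm
  have mE : Measurable ofVertHor := measurePreserving_ofVertHor.measurable
  have key := lintegral_pow_four_le_of_sq_le_prod_prod (volume : Measure ℝ) (volume : Measure ℝ)
    (volume : Measure ℝ) (mf.comp mE) ((md 0).comp mE) ((md 1).comp mE) ((md 2).comp mE)
    (fun c a b => by
      simpa only [Function.comp_apply, ofVertHor_update_zero] using
        hf.enorm_sq_le_lintegral 0 (ofVertHor (c, a, b)))
    (fun c a b => by
      simpa only [Function.comp_apply, ofVertHor_update_one] using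
        hf.enorm_sq_le_lintegral 1 (ofVertHor (c, a, b)))
    (fun c a b => by
      simpa only [Function.comp_apply, ofVertHor_update_two] using
        hf.enorm_sq_le_lintegral 2 (ofVertHor (c, a, b)))
  simp only [Function.comp_apply] at key
  rw [lintegral_ofVertHor (mf.pow_const 4), lintegral_ofVertHor (mf.pow_const 2),
    lintegral_ofVertHor ((md 0).pow_const 2), lintegral_ofVertHor ((md 1).pow_const 2),
    lintegral_ofVertHor ((md 2).pow_const 2), lintegral_enorm_sq_eq_ofReal_l2Sq hf.integrable_sq,
    lintegral_enorm_sq_eq_ofReal_l2Sq (hf.integrable_pd_sq 0),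
    lintegral_enorm_sq_eq_ofReal_l2Sq (hf.integrable_pd_sq 1),
    lintegral_enorm_sq_eq_ofReal_l2Sq (hf.integrable_pd_sq 2)] at key
  have hsqrt : ∀ g : Pt → ℝ, ENNReal.ofReal (l2Sq g) ^ ((1:ℝ)/2) = ENNReal.ofReal √(l2Sq g) :=
    fun g => by
      rw [ENNReal.ofReal_rpow_of_nonneg (l2Sq_nonneg g) (by norm_num), Real.sqrt_eq_rpow]
  simp only [hsqrt] at key
  rw [← ENNReal.ofReal_mul (by positivity), ← ENNReal.ofReal_mul (by positivity),
    ← ENNReal.ofReal_mul (by positivity)] at key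
  rw [integral_eq_lintegral_of_nonneg_ae (ae_of_all _ fun x => by positivity)
    (show Continuous fun x => f x ^ 4 from hf.1.continuous.pow 4).aestronglyMeasurable]
  refine ENNReal.toReal_le_of_le_ofReal (by positivity) (le_trans (le_of_eq ?_) key)
  refine lintegral_congr fun x => ?_
  rw [← enorm_pow, Real.enorm_of_nonneg (by positivity)]

/-- Anisotropic Gagliardo–Nirenberg–Sobolev estimate:
`‖f‖_{L⁴_T(L⁴)} ≤ C ‖f‖_{L^∞_T(L²)}^{1/4} ‖∂₃f‖_{L^∞_T(L²)}^{1/4} ‖∇_h f‖_{L²_T(L²)}^{1/2}`. -/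
theorem stmt_4 :
    ∃ C : ℝ, 0 < C ∧ ∀ T : ℝ, 0 < T → ∀ f : ℝ → Pt → ℝ,
      SmoothOn2 (Icc 0 T) f → (∀ t ∈ Icc (0:ℝ) T, IsSchwartz (f t)) →
      BddAbove ((fun t => Real.sqrt (l2Sq (f t))) '' Icc 0 T) →
      BddAbove ((fun t => Real.sqrt (l2Sq (pd 2 (f t)))) '' Icc 0 T) →
      IntervalIntegrable (fun t => ∑ i ∈ hIdx, l2Sq (pd i (f t))) volume 0 T →
      l4T T (fun t => (∫ x : Pt, (f t x) ^ 4) ^ ((1:ℝ)/4)) ≤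
        C * (supT T fun t => Real.sqrt (l2Sq (f t))) ^ ((1:ℝ)/4)
          * (supT T fun t => Real.sqrt (l2Sq (pd 2 (f t)))) ^ ((1:ℝ)/4)
          * (l2T T fun t => Real.sqrt (∑ i ∈ hIdx, l2Sq (pd i (f t)))) ^ ((1:ℝ)/2) := by
  refine ⟨1, one_pos, fun T hT f _ hf hA hB hI => ?_⟩
  set A := supT T fun t => √(l2Sq (f t))
  set B := supT T fun t => √(l2Sq (pd 2 (f t)))
  have hA0 : 0 ≤ A := Real.sSup_nonneg (by rintro _ ⟨t, -, rfl⟩; positivity)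
  have hB0 : 0 ≤ B := Real.sSup_nonneg (by rintro _ ⟨t, -, rfl⟩; positivity)
  have hG0 : ∀ t, 0 ≤ ∑ i ∈ hIdx, l2Sq (pd i (f t)) :=
    fun t => Finset.sum_nonneg fun i _ => l2Sq_nonneg _
  have hpow : ∀ t, ((∫ x : Pt, (f t x) ^ 4) ^ ((1:ℝ)/4)) ^ 4 = ∫ x : Pt, (f t x) ^ 4 := fun t => by
    rw [← Real.rpow_natCast, ← Real.rpow_mul (integral_nonneg fun x => by positivity)]
    norm_num
  have hslice : ∀ t ∈ Icc (0:ℝ) T,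
      ∫ x : Pt, (f t x) ^ 4 ≤ A * B * ∑ i ∈ hIdx, l2Sq (pd i (f t)) := fun t ht => by
    have hAt : √(l2Sq (f t)) ≤ A := le_csSup hA ⟨t, ht, rfl⟩
    have hBt : √(l2Sq (pd 2 (f t))) ≤ B := le_csSup hB ⟨t, ht, rfl⟩
    have hsum : ∑ i ∈ hIdx, l2Sq (pd i (f t)) = l2Sq (pd 0 (f t)) + l2Sq (pd 1 (f t)) := by
      simp [hIdx]
    have hh : √(l2Sq (pd 0 (f t))) * √(l2Sq (pd 1 (f t))) ≤ ∑ i ∈ hIdx, l2Sq (pd i (f t)) := by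
      rw [hsum]
      nlinarith [sq_nonneg (√(l2Sq (pd 0 (f t))) - √(l2Sq (pd 1 (f t)))),
        Real.sq_sqrt (l2Sq_nonneg (pd 0 (f t))), Real.sq_sqrt (l2Sq_nonneg (pd 1 (f t))),
        l2Sq_nonneg (pd 0 (f t)), l2Sq_nonneg (pd 1 (f t))]
    refine (hf t ht).integral_pow_four_le.trans ?_
    gcongr
  have htime : ∫ t in (0:ℝ)..T, ∫ x : Pt, (f t x) ^ 4 ≤
      A * B * ∫ t in (0:ℝ)..T, ∑ i ∈ hIdx, l2Sq (pd i (f t)) := by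
    rw [← intervalIntegral.integral_const_mul, intervalIntegral.integral_of_le hT.le,
      intervalIntegral.integral_of_le hT.le]
    refine integral_mono_of_nonneg
      (ae_of_all _ fun t => integral_nonneg fun x => by positivity) (hI.1.const_mul _) ?_
    filter_upwards [ae_restrict_mem measurableSet_Ioc] with t ht
    exact hslice t (Ioc_subset_Icc_self ht)
  have hI0 : 0 ≤ ∫ t in (0:ℝ)..T, ∑ i ∈ hIdx, l2Sq (pd i (f t)) :=
    intervalIntegral.integral_nonneg hT.le fun t _ => hG0 t
  simp only [l4T, l2T, hpow, fun t => Real.sq_sqrt (hG0 t)]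
  rw [one_mul, Real.sqrt_eq_rpow, ← Real.rpow_mul hI0, ← Real.mul_rpow hA0 hB0,
    show (1:ℝ) / 2 * (1 / 2) = 1 / 4 by norm_num, ← Real.mul_rpow (by positivity) hI0]
  refine Real.rpow_le_rpow ?_ htime (by norm_num)
  exact intervalIntegral.integral_nonneg hT.le fun t _ => integral_nonneg fun x => by positivity

end
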